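/- Let n, m be nonnegative integers with m ≥ 1 and n ≠ m − 1, let κ be a nonzero real number and b a real number. Then ∫₀^b t^n e^{iκt} J_m(κt) dt = (e^{iκb} b^{n+1}/(n − m + 1)) · ( J_m(κb) + i J_{m−1}(κb) ) − (i(n + m)/(n − m + 1)) ∫₀^b t^n e^{iκt} J_{m−1}(κt) dt. -/

import Mathlib

open Real MeasureTheory Complex

/-- Bessel function of the first kind of nonnegative integer order `m`. -/
noncomputable def besselJ (m : ℕ) (x : ℝ) : ℝ :=
  ∑' j : ℕ, ((-1 : ℝ) ^ j / ((j.factorial : ℝ) * ((j + m).factorial : ℝ))) * (x / 2) ^ (2 * j + m)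

/-- The entire function `E_m(y) = ∑ (-1)^j y^j / (j! (j+m)!)`, for which
`J_m(x) = (x/2)^m E_m((x/2)^2)`. -/
noncomputable def besselSeries (m : ℕ) (y : ℝ) : ℝ :=
  ∑' j : ℕ, ((-1 : ℝ) ^ j / ((j.factorial : ℝ) * ((j + m).factorial : ℝ))) * y ^ j

lemma abs_besselSeries_coeff_le (m j : ℕ) :
    |(-1 : ℝ) ^ j / ((j.factorial : ℝ) * ((j + m).factorial : ℝ))| ≤ 1 / (j.factorial : ℝ) := by
  rw [abs_div, abs_pow, abs_neg, abs_one, one_pow, abs_of_nonneg (by positivity)]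
  have h : (1 : ℝ) ≤ ((j + m).factorial : ℝ) := by exact_mod_cast Nat.factorial_pos _
  have h' : (0 : ℝ) < (j.factorial : ℝ) := by positivity
  exact one_div_le_one_div_of_le h' (le_mul_of_one_le_right h'.le h)

lemma summable_besselSeries (m : ℕ) (y : ℝ) :
    Summable fun j : ℕ =>
      ((-1 : ℝ) ^ j / ((j.factorial : ℝ) * ((j + m).factorial : ℝ))) * y ^ j := by
  refine Summable.of_norm_bounded (Real.summable_pow_div_factorial |y|) fun j => ?_
  rw [Real.norm_eq_abs, abs_mul, abs_pow, div_eq_mul_one_div (|y| ^ j), mul_comm]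
  exact mul_le_mul_of_nonneg_left (abs_besselSeries_coeff_le m j) (by positivity)

lemma besselJ_eq_besselSeries (m : ℕ) (x : ℝ) :
    besselJ m x = (x / 2) ^ m * besselSeries m ((x / 2) ^ 2) := by
  rw [besselJ, besselSeries, ← tsum_mul_left]
  refine tsum_congr fun j => ?_
  rw [pow_add, pow_mul]
  ring

lemma hasDerivAt_besselSeries (m : ℕ) (y : ℝ) :
    HasDerivAt (besselSeries m) (-besselSeries (m + 1) y) y := by
  have hu : Summable fun j : ℕ => (j : ℝ) * (|y| + 1) ^ (j - 1) / (j.factorial : ℝ) := by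
    rw [← summable_nat_add_iff 1]
    refine (Real.summable_pow_div_factorial (|y| + 1)).congr fun j => ?_
    rw [Nat.factorial_succ, Nat.add_sub_cancel]
    push_cast
    field_simp
  have hy : y ∈ Metric.ball (0 : ℝ) (|y| + 1) := by simp
  have hbound : ∀ (j : ℕ) (z : ℝ), z ∈ Metric.ball (0 : ℝ) (|y| + 1) →
      ‖((-1 : ℝ) ^ j / ((j.factorial : ℝ) * ((j + m).factorial : ℝ))) * (j * z ^ (j - 1))‖ ≤
        (j : ℝ) * (|y| + 1) ^ (j - 1) / (j.factorial : ℝ) := by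
    intro j z hz
    have hz' : |z| ≤ |y| + 1 := by
      simpa using (Metric.mem_ball.mp hz).le
    rw [Real.norm_eq_abs, abs_mul, abs_mul, abs_pow, Nat.abs_cast,
      div_eq_mul_one_div (_ * (|y| + 1) ^ (j - 1)), mul_comm (_ * (|y| + 1) ^ (j - 1))]
    exact mul_le_mul (abs_besselSeries_coeff_le m j) (by gcongr) (by positivity) (by positivity)
  have h := hasDerivAt_tsum_of_isPreconnected hu Metric.isOpen_ball
    (convex_ball (0 : ℝ) (|y| + 1)).isPreconnected
    (fun j z _ => (hasDerivAt_pow j z).const_mul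
      ((-1 : ℝ) ^ j / ((j.factorial : ℝ) * ((j + m).factorial : ℝ))))
    hbound hy (summable_besselSeries m y) hy
  refine h.congr_deriv ?_
  rw [(Summable.of_norm_bounded hu fun j => hbound j y hy).tsum_eq_zero_add, besselSeries,
    ← tsum_neg]
  simp only [Nat.cast_zero, zero_mul, mul_zero, zero_add]
  refine tsum_congr fun j => ?_
  rw [Nat.add_sub_cancel, show j + 1 + m = j + (m + 1) by ring, Nat.factorial_succ j]
  push_cast
  field_simp
  ring

lemma besselSeries_recurrence (m : ℕ) (y : ℝ) :
    besselSeries m y = (m + 1) * besselSeries (m + 1) y - y * besselSeries (m + 2) y := by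
  have hshift : y * besselSeries (m + 2) y = -∑' j : ℕ,
      ((-1 : ℝ) ^ j / ((j.factorial : ℝ) * ((j + (m + 1)).factorial : ℝ))) * y ^ j * j := by
    have hs : Summable fun j : ℕ =>
        ((-1 : ℝ) ^ j / ((j.factorial : ℝ) * ((j + (m + 1)).factorial : ℝ))) * y ^ j * j := by
      refine ((summable_besselSeries m y).sub
        ((summable_besselSeries (m + 1) y).mul_left ((m : ℝ) + 1))).congr fun j => ?_
      rw [show j + (m + 1) = (j + m) + 1 by ring, Nat.factorial_succ (j + m)]
      push_cast
      field_simp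
      ring
    rw [hs.tsum_eq_zero_add, besselSeries, ← tsum_mul_left]
    simp only [Nat.cast_zero, mul_zero, zero_add]
    rw [← tsum_neg]
    refine tsum_congr fun j => ?_
    rw [show j + 1 + (m + 1) = j + (m + 2) by ring, Nat.factorial_succ j]
    push_cast
    field_simp
    ring
  have hs := summable_besselSeries (m + 1) y
  have hsum : besselSeries m y - (m + 1) * besselSeries (m + 1) y = ∑' j : ℕ,
      ((-1 : ℝ) ^ j / ((j.factorial : ℝ) * ((j + (m + 1)).factorial : ℝ))) * y ^ j * j := by
    rw [besselSeries, besselSeries, ← tsum_mul_left,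
      ← (summable_besselSeries m y).tsum_sub (hs.mul_left _)]
    refine tsum_congr fun j => ?_
    rw [show j + (m + 1) = (j + m) + 1 by ring, Nat.factorial_succ (j + m)]
    push_cast
    field_simp
    ring
  linarith

lemma hasDerivAt_besselJ (m : ℕ) (x : ℝ) :
    HasDerivAt (besselJ m)
      (m * (x / 2) ^ (m - 1) / 2 * besselSeries m ((x / 2) ^ 2) - besselJ (m + 1) x) x := by
  have hx : HasDerivAt (fun x : ℝ => x / 2) (1 / 2) x := (hasDerivAt_id x).div_const 2
  have h := (hx.pow m).mul ((hasDerivAt_besselSeries m ((x / 2) ^ 2)).comp x (hx.pow 2))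
  rw [funext (besselJ_eq_besselSeries m)]
  refine h.congr_deriv ?_
  rw [besselJ_eq_besselSeries]
  simp only [Pi.pow_apply, Function.comp_apply]
  push_cast
  ring

lemma differentiable_besselJ (m : ℕ) : Differentiable ℝ (besselJ m) :=
  fun x => (hasDerivAt_besselJ m x).differentiableAt

/-- `x J_m'(x) = m J_m(x) - x J_{m+1}(x)`. -/
lemma mul_deriv_besselJ (m : ℕ) (x : ℝ) :
    x * deriv (besselJ m) x = m * besselJ m x - x * besselJ (m + 1) x := by
  rw [(hasDerivAt_besselJ m x).deriv, besselJ_eq_besselSeries m]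
  rcases m with _ | k
  · simp
  · rw [Nat.add_sub_cancel]
    ring

/-- `x J_{m+1}'(x) = x J_m(x) - (m + 1) J_{m+1}(x)`. -/
lemma mul_deriv_besselJ_succ (m : ℕ) (x : ℝ) :
    x * deriv (besselJ (m + 1)) x = x * besselJ m x - (m + 1) * besselJ (m + 1) x := by
  rw [mul_deriv_besselJ, besselJ_eq_besselSeries m, besselJ_eq_besselSeries (m + 1),
    besselJ_eq_besselSeries (m + 1 + 1), besselSeries_recurrence m]
  push_cast
  ring

lemma hasDerivAt_exp_mul_pow_mul_besselJ (n k : ℕ) (κ t : ℝ) :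
    HasDerivAt (fun t : ℝ => Complex.exp (Complex.I * κ * t) * (t : ℂ) ^ (n + 1) *
        ((besselJ (k + 1) (κ * t) : ℂ) + Complex.I * (besselJ k (κ * t) : ℂ)))
      (((n : ℂ) - k) *
          ((t : ℂ) ^ n * Complex.exp (Complex.I * κ * t) * (besselJ (k + 1) (κ * t) : ℂ)) +
        Complex.I * ((n : ℂ) + k + 1) *
          ((t : ℂ) ^ n * Complex.exp (Complex.I * κ * t) * (besselJ k (κ * t) : ℂ))) t := by
  have ht : HasDerivAt (fun t : ℝ => (t : ℂ)) 1 t := Complex.ofRealCLM.hasDerivAt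
  have hJ : ∀ j : ℕ, HasDerivAt (fun t : ℝ => (besselJ j (κ * t) : ℂ))
      ((deriv (besselJ j) (κ * t) * κ : ℝ) : ℂ) t := fun j =>
    ((differentiable_besselJ j (κ * t)).hasDerivAt.comp t
      (((hasDerivAt_id t).const_mul κ).congr_deriv (mul_one κ))).ofReal_comp
  have h := ((ht.const_mul (Complex.I * κ)).cexp.mul (ht.pow (n + 1))).mul
    ((hJ (k + 1)).add ((hJ k).const_mul Complex.I))
  refine h.congr_deriv ?_
  have h₁ : (κ : ℂ) * t * ((deriv (besselJ (k + 1)) (κ * t) : ℝ) : ℂ) =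
      κ * t * besselJ k (κ * t) - (k + 1) * besselJ (k + 1) (κ * t) := by
    exact_mod_cast mul_deriv_besselJ_succ k (κ * t)
  have h₂ : (κ : ℂ) * t * ((deriv (besselJ k) (κ * t) : ℝ) : ℂ) =
      k * besselJ k (κ * t) - κ * t * besselJ (k + 1) (κ * t) := by
    exact_mod_cast mul_deriv_besselJ k (κ * t)
  simp only [Pi.mul_apply, Pi.pow_apply, Pi.add_apply, Nat.add_sub_cancel]
  push_cast
  linear_combination Complex.exp (Complex.I * κ * t) * (t : ℂ) ^ n * h₁ +
    Complex.I * Complex.exp (Complex.I * κ * t) * (t : ℂ) ^ n * h₂ +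
    Complex.exp (Complex.I * κ * t) * (t : ℂ) ^ n * κ * t * besselJ k (κ * t) * Complex.I_sq

theorem stmt_16 (n m : ℕ) (hm : 1 ≤ m) (hnm : (n : ℤ) ≠ (m : ℤ) - 1) (κ b : ℝ) (hκ : κ ≠ 0) :
    ∫ t in (0:ℝ)..b, (t : ℂ) ^ n * Complex.exp (Complex.I * κ * t) * (besselJ m (κ * t) : ℂ) =
      (Complex.exp (Complex.I * κ * b) * (b : ℂ) ^ (n + 1) / ((n : ℂ) - m + 1)) *
          ((besselJ m (κ * b) : ℂ) + Complex.I * (besselJ (m - 1) (κ * b) : ℂ)) -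
        (Complex.I * ((n : ℂ) + m) / ((n : ℂ) - m + 1)) *
          ∫ t in (0:ℝ)..b,
            (t : ℂ) ^ n * Complex.exp (Complex.I * κ * t) * (besselJ (m - 1) (κ * t) : ℂ) := by
  obtain ⟨k, rfl⟩ := Nat.exists_eq_add_of_le' hm
  rw [Nat.add_sub_cancel]
  have hcont : ∀ j : ℕ, Continuous fun t : ℝ =>
      (t : ℂ) ^ n * Complex.exp (Complex.I * κ * t) * (besselJ j (κ * t) : ℂ) := by
    intro j
    have := (differentiable_besselJ j).continuous
    fun_prop
  have hi := fun j => (hcont j).intervalIntegrable (μ := volume) 0 b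
  have hftc := intervalIntegral.integral_eq_sub_of_hasDerivAt
    (fun t _ => hasDerivAt_exp_mul_pow_mul_besselJ n k κ t)
    (((hi (k + 1)).const_mul _).add ((hi k).const_mul _))
  rw [intervalIntegral.integral_add ((hi (k + 1)).const_mul _) ((hi k).const_mul _),
    intervalIntegral.integral_const_mul, intervalIntegral.integral_const_mul] at hftc
  simp only [Complex.ofReal_zero, zero_pow n.succ_ne_zero, mul_zero, zero_mul, sub_zero] at hftc
  have hne : (n : ℂ) - k ≠ 0 := by
    rw [sub_ne_zero]
    intro h
    apply hnm
    push_cast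
    have : n = k := by exact_mod_cast h
    omega
  have hden : (n : ℂ) - ((k + 1 : ℕ) : ℂ) + 1 = n - k := by push_cast; ring
  rw [hden]
  push_cast
  field_simp
  linear_combination hftc
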